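/- Let p, q, r be pairwise distinct complex numbers and define f(z) = ((p*q - 2*q*r + r*p)*z + p*(q - r)) / ((2*p - q - r)*z + (q - r)). Then the product of the complex derivatives of f at 0 and at 1 satisfies f'(0) * f'(1) = (p - q)^2. -/

import Mathlib

theorem hasDerivAt_moebius (a b c d z : ℂ) (hz : c * z + d ≠ 0) :
    HasDerivAt (fun w => (a * w + b) / (c * w + d)) ((a * d - b * c) / (c * z + d) ^ 2) z := by
  have linear (s t : ℂ) : HasDerivAt (fun w => s * w + t) s z := by
    simpa using ((hasDerivAt_id z).const_mul s).add_const t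
  refine ((linear a b).fun_div (linear c d) hz).congr_deriv ?_
  ring

/-- For the Möbius transformation f sending (0, 1, -1) to (p, q, r),
the product of the derivatives at 0 and 1 equals (p - q)^2. -/
theorem moebius_deriv_product_two (p q r : ℂ) (hpq : p ≠ q) (hqr : q ≠ r) (hpr : p ≠ r)
    (f : ℂ → ℂ)
    (hf : f = fun z => ((p * q - 2 * q * r + r * p) * z + p * (q - r)) /
      ((2 * p - q - r) * z + (q - r))) :
    deriv f 0 * deriv f 1 = (p - q) ^ 2 := by
  have hqr' : q - r ≠ 0 := sub_ne_zero.mpr hqr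
  have hpr' : p - r ≠ 0 := sub_ne_zero.mpr hpr
  have h0 : (2 * p - q - r) * 0 + (q - r) = q - r := by ring
  have h1 : (2 * p - q - r) * 1 + (q - r) = 2 * (p - r) := by ring
  have hdet : (p * q - 2 * q * r + r * p) * (q - r) - p * (q - r) * (2 * p - q - r) =
      -2 * (q - r) * (p - q) * (p - r) := by ring
  rw [hf, (hasDerivAt_moebius _ _ _ _ 0 (by rwa [h0])).deriv,
    (hasDerivAt_moebius _ _ _ _ 1 (by rw [h1]; exact mul_ne_zero two_ne_zero hpr')).deriv,
    h0, h1, hdet]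
  field_simp
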